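/- Let π be an abelian group and let k ≤ n be natural numbers. The map sending a π-valued k-cocycle z on Δⁿ to its restriction to the set of k-faces that contain the vertex 0 is a bijection from the set of k-cocycles on Δⁿ to the set of all π-valued functions on the k-faces containing 0. -/

import Mathlib

/-- A `k`-face of the standard `n`-simplex: a `(k+1)`-element subset of `{0,…,n}`. -/
def SimplexFace (n k : ℕ) : Type := {s : Finset (Fin (n + 1)) // s.card = k + 1}

/-- A `π`-valued `k`-cochain on the standard `n`-simplex. -/
abbrev Cochain (n k : ℕ) (π : Type*) [AddCommGroup π] : Type _ := SimplexFace n k → π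

/-- The coboundary of a `k`-cochain: its value on a `(k+1)`-face `t = {a₀ < ⋯ < a_{k+1}}`
is `Σ_i (-1)^i • z (t \ {a_i})`, where `i` is the position of `a_i` in `t`. -/
def coboundary {n k : ℕ} {π : Type*} [AddCommGroup π] (z : Cochain n k π) :
    Cochain n (k + 1) π :=
  fun t => ∑ a ∈ t.1.attach,
    ((-1 : ℤ) ^ ((t.1.filter (fun x => x < a.1)).card)) •
      z ⟨t.1.erase a.1, by simp [Finset.card_erase_of_mem a.2, t.2]⟩

/-- The sign `(-1)^i`, where `i` is the number of elements of `s` below `a`. -/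
def positionSign {α : Type*} [LinearOrder α] (s : Finset α) (a : α) : ℤ :=
  (-1) ^ (s.filter (fun x => x < a)).card

/-- The alternating sum of a function over the facets of a finite set. -/
def facetSum {α π : Type*} [LinearOrder α] [AddCommGroup π] (F : Finset α → π)
    (t : Finset α) : π :=
  ∑ a ∈ t, positionSign t a • F (t.erase a)

theorem positionSign_erase_of_lt {α : Type*} [LinearOrder α] {s : Finset α} {a b : α}
    (ha : a ∈ s) (hab : a < b) : positionSign (s.erase a) b = -positionSign s b := by
  have hmem : a ∈ s.filter (fun x => x < b) := Finset.mem_filter.2 ⟨ha, hab⟩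
  rw [positionSign, positionSign, Finset.filter_erase, ← Finset.card_erase_add_one hmem, pow_succ]
  ring

theorem positionSign_erase_of_le {α : Type*} [LinearOrder α] {s : Finset α} {a b : α}
    (hba : b ≤ a) : positionSign (s.erase a) b = positionSign s b := by
  rw [positionSign, positionSign, Finset.filter_erase, Finset.erase_eq_of_notMem]
  simp [hba]

theorem positionSign_mul_erase_swap {α : Type*} [LinearOrder α] {s : Finset α} {a b : α}
    (ha : a ∈ s) (hb : b ∈ s) (hab : a ≠ b) :
    positionSign s a * positionSign (s.erase a) b +
      positionSign s b * positionSign (s.erase b) a = 0 := by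
  rcases lt_or_gt_of_ne hab with h | h
  · rw [positionSign_erase_of_lt ha h, positionSign_erase_of_le h.le]
    ring
  · rw [positionSign_erase_of_lt hb h, positionSign_erase_of_le h.le]
    ring

theorem facetSum_facetSum {α π : Type*} [LinearOrder α] [AddCommGroup π]
    (F : Finset α → π) (t : Finset α) : facetSum (facetSum F) t = 0 := by
  simp only [facetSum, Finset.smul_sum, smul_smul]
  rw [Finset.sum_sigma']
  refine Finset.sum_involution (fun p _ => ⟨p.2, p.1⟩) ?_ ?_ ?_ ?_
  · rintro ⟨a, b⟩ h
    simp only [Finset.mem_sigma, Finset.mem_erase] at h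
    rw [Finset.erase_right_comm (a := b), ← add_smul,
      positionSign_mul_erase_swap h.1 h.2.2 h.2.1.symm, zero_smul]
  · rintro ⟨a, b⟩ h _ heq
    simp only [Finset.mem_sigma, Finset.mem_erase] at h
    exact h.2.1 (congrArg Sigma.fst heq)
  · rintro ⟨a, b⟩ h
    simp only [Finset.mem_sigma, Finset.mem_erase] at h ⊢
    exact ⟨h.2.2, h.2.1.symm, h.1⟩
  · rintro ⟨a, b⟩ _
    rfl

theorem facetSum_insert_bot {α π : Type*} [LinearOrder α] [OrderBot α] [AddCommGroup π]
    (F : Finset α → π) {s : Finset α} (hs : ⊥ ∉ s) :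
    facetSum F (insert ⊥ s) = F s - facetSum (fun r => F (insert ⊥ r)) s := by
  rw [facetSum, Finset.sum_insert hs, Finset.erase_insert hs, facetSum, sub_eq_add_neg,
    ← Finset.sum_neg_distrib]
  congr 1
  · simp [positionSign]
  · refine Finset.sum_congr rfl fun a ha => ?_
    have hne : ⊥ ≠ a := fun h => hs (h ▸ ha)
    have hsign := positionSign_erase_of_lt (Finset.mem_insert_self ⊥ s)
      (bot_lt_iff_ne_bot.2 hne.symm)
    rw [Finset.erase_insert hs] at hsign
    rw [Finset.erase_insert_of_ne hne, hsign, neg_smul, neg_neg]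

theorem coboundary_eq_facetSum {n k : ℕ} {π : Type*} [AddCommGroup π] {z : Cochain n k π}
    {F : Finset (Fin (n + 1)) → π} (h : ∀ s, z s = F s.1) (t : SimplexFace n (k + 1)) :
    coboundary z t = facetSum F t.1 := by
  refine (Finset.sum_congr rfl fun a _ => congrArg _ (h _)).trans ?_
  exact Finset.sum_attach t.1 fun a => positionSign t.1 a • F (t.1.erase a)

theorem facetSum_eq_zero_of_bot_mem {α π : Type*} [LinearOrder α] [OrderBot α] [AddCommGroup π]
    {F : Finset α → π} (h : ∀ s, ⊥ ∉ s → F s = facetSum (fun r => F (insert ⊥ r)) s)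
    {t : Finset α} (ht : ⊥ ∈ t) : facetSum F t = 0 := by
  have hs := Finset.notMem_erase ⊥ t
  rw [← Finset.insert_erase ht, facetSum_insert_bot F hs, ← h _ hs, sub_self]

theorem facetSum_eq_zero {α π : Type*} [LinearOrder α] [OrderBot α] [AddCommGroup π]
    {F : Finset α → π} (h : ∀ s, ⊥ ∉ s → F s = facetSum (fun r => F (insert ⊥ r)) s)
    (t : Finset α) : facetSum F t = 0 := by
  by_cases ht : ⊥ ∈ t
  · exact facetSum_eq_zero_of_bot_mem h ht
  · rw [← facetSum_facetSum (fun r => F (insert ⊥ r)) t]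
    refine Finset.sum_congr rfl fun a _ => ?_
    rw [h _ fun hm => ht (Finset.mem_of_mem_erase hm)]

/-- A cocycle is determined on the faces avoiding `0` by its values on the faces through `0`. -/
theorem eq_facetSum_of_coboundary_eq_zero {n k : ℕ} {π : Type*} [AddCommGroup π]
    {z : Cochain n k π} (hz : coboundary z = 0) {F : Finset (Fin (n + 1)) → π}
    (h : ∀ s, z s = F s.1) (s : SimplexFace n k) (hs : 0 ∉ s.1) :
    z s = facetSum (fun r => F (insert 0 r)) s.1 := by
  have ht := coboundary_eq_facetSum h
    ⟨insert 0 s.1, by rw [Finset.card_insert_of_notMem hs, s.2]⟩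
  rw [hz] at ht
  rw [h s]
  exact sub_eq_zero.1 ((facetSum_insert_bot F hs).symm.trans ht.symm)

/-- Restriction to the `k`-faces containing the vertex `0` is a bijection from the set of
`π`-valued `k`-cocycles on the standard `n`-simplex to the set of all `π`-valued functions on
the `k`-faces containing `0`. -/
theorem cocycle_restriction_bijective (n k : ℕ) (hkn : k ≤ n)
    (π : Type*) [AddCommGroup π] :
    Function.Bijective
      (fun (z : {z : Cochain n k π // coboundary z = 0})
           (s : {s : SimplexFace n k // (0 : Fin (n + 1)) ∈ s.1}) => z.1 s.1) := by
  classical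
  constructor
  · rintro ⟨z, hz⟩ ⟨w, hw⟩ hzw
    have hval (s : SimplexFace n k) (hs : 0 ∈ s.1) : z s = w s := congrFun hzw ⟨s, hs⟩
    let extend (y : Cochain n k π) (s : Finset (Fin (n + 1))) : π :=
      if h : s.card = k + 1 then y ⟨s, h⟩ else 0
    have hextend (y : Cochain n k π) (s : SimplexFace n k) : y s = extend y s.1 :=
      (show extend y s.1 = y ⟨s.1, s.2⟩ from dif_pos s.2).symm
    have hcone : (fun r => extend z (insert 0 r)) = fun r => extend w (insert 0 r) := by
      funext r
      by_cases h : (insert 0 r).card = k + 1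
      · simpa only [extend, dif_pos h] using hval ⟨_, h⟩ (Finset.mem_insert_self 0 r)
      · simp only [extend, dif_neg h]
    refine Subtype.ext (funext fun s => ?_)
    by_cases hs : 0 ∈ s.1
    · exact hval s hs
    · change z s = w s
      rw [eq_facetSum_of_coboundary_eq_zero hz (hextend z) s hs,
        eq_facetSum_of_coboundary_eq_zero hw (hextend w) s hs, hcone]
  · intro g
    let G (s : Finset (Fin (n + 1))) : π :=
      if h : s.card = k + 1 ∧ 0 ∈ s then g ⟨⟨s, h.1⟩, h.2⟩ else 0
    let F (s : Finset (Fin (n + 1))) : π :=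
      if 0 ∈ s then G s else facetSum (fun r => G (insert 0 r)) s
    have hF (s : Finset (Fin (n + 1))) (hs : ⊥ ∉ s) :
        F s = facetSum (fun r => F (insert ⊥ r)) s := by
      have hcone : (fun r => F (insert ⊥ r)) = fun r => G (insert 0 r) :=
        funext fun r => if_pos (Finset.mem_insert_self 0 r)
      rw [hcone]
      exact if_neg hs
    refine ⟨⟨fun s => F s.1, funext fun t => ?_⟩, funext fun s => ?_⟩
    · exact (coboundary_eq_facetSum (fun _ => rfl) t).trans (facetSum_eq_zero hF t.1)
    · exact (if_pos s.2).trans (dif_pos ⟨s.1.2, s.2⟩)
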